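/- Let ε > 0 be a real number, let d ≥ 1 be an integer, and let K ⊆ ℝ^d be a convex body. If there exists a volume-preserving affine transformation f : ℝ^d → ℝ^d such that f(K) has diameter D with D ≤ d^{1−ε} · λ_d(K)^{1/d}, then p_d^K ≤ (d+2) · d^{(1−ε)d} / d!. -/

import Mathlib

open MeasureTheory Filter

noncomputable section

abbrev Euc (d : ℕ) : Type := EuclideanSpace ℝ (Fin d)

/-- A convex body: compact convex set with nonempty interior. -/
def IsConvexBody {d : ℕ} (K : Set (Euc d)) : Prop :=
  Convex ℝ K ∧ IsCompact K ∧ (interior K).Nonempty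

/-- A set of points is in convex position if no point lies in the convex
hull of the others. -/
def InConvexPosition {d : ℕ} (P : Set (Euc d)) : Prop :=
  ∀ p ∈ P, p ∉ convexHull ℝ (P \ {p})

/-- `H` is a `k`-hole in `S`. -/
def IsHole {d : ℕ} (k : ℕ) (S H : Finset (Euc d)) : Prop :=
  H ⊆ S ∧ H.card = k ∧ InConvexPosition (H : Set (Euc d)) ∧
    ∀ p ∈ S, p ∉ interior (convexHull ℝ (H : Set (Euc d)))

open Classical in
/-- The number of `k`-holes in the point set given by `x`. -/
noncomputable def holeCount (d k n : ℕ) (x : Fin n → Euc d) : ℕ :=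
  ((Finset.image x Finset.univ).powerset.filter
    (fun H => IsHole k (Finset.image x Finset.univ) H)).card

/-- The uniform probability distribution on `K`. -/
noncomputable def unif {d : ℕ} (K : Set (Euc d)) : Measure (Euc d) :=
  (volume K)⁻¹ • volume.restrict K

/-- The expected number of `k`-holes among `n` points drawn uniformly and
independently at random from `K`. -/
noncomputable def EH (d k : ℕ) (K : Set (Euc d)) (n : ℕ) : ℝ :=
  ∫ x : Fin n → Euc d, (holeCount d k n x : ℝ) ∂(Measure.pi fun _ : Fin n => unif K)

/-- The probability that, for `d+2` points chosen uniformly and independently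
at random from `K`, one of the points lies in the convex hull of the others. -/
noncomputable def pSimplex (d : ℕ) (K : Set (Euc d)) : ℝ :=
  ((Measure.pi fun _ : Fin (d + 2) => unif K)
    {x : Fin (d + 2) → Euc d | ∃ i, x i ∈ convexHull ℝ (x '' {j | j ≠ i})}).toReal

/-- The maximum of `pSimplex d K` over all convex bodies `K ⊆ ℝ^d`. -/
noncomputable def pMax (d : ℕ) : ℝ :=
  sSup {p : ℝ | ∃ K : Set (Euc d), IsConvexBody K ∧ p = pSimplex d K}

end

/-- The corner simplex spanned by `0` and the points `t • eᵢ`. -/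
def cornerSimplex (n : ℕ) (t : ℝ) : Set (Fin n → ℝ) :=
  {x | (∀ i, 0 ≤ x i) ∧ ∑ i, x i ≤ t}

theorem isClosed_cornerSimplex (n : ℕ) (t : ℝ) : IsClosed (cornerSimplex n t) := by
  have h : cornerSimplex n t = (⋂ i, {x | 0 ≤ x i}) ∩ {x | ∑ i, x i ≤ t} := by
    ext x; simp [cornerSimplex]
  rw [h]
  exact (isClosed_iInter fun i => isClosed_le (by fun_prop) (by fun_prop)).inter
    (isClosed_le (by fun_prop) (by fun_prop))

theorem convex_cornerSimplex (n : ℕ) (t : ℝ) : Convex ℝ (cornerSimplex n t) := by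
  rintro x ⟨hx, hxt⟩ y ⟨hy, hyt⟩ a b ha hb hab
  refine ⟨fun i => add_nonneg (mul_nonneg ha (hx i)) (mul_nonneg hb (hy i)), ?_⟩
  simp only [Pi.add_apply, Pi.smul_apply, smul_eq_mul, Finset.sum_add_distrib, ← Finset.mul_sum]
  have : t = a * t + b * t := by rw [← add_mul, hab, one_mul]
  rw [this]
  gcongr

theorem volume_cornerSimplex (n : ℕ) (t : ℝ) (ht : 0 ≤ t) :
    volume (cornerSimplex n t) = ENNReal.ofReal (t ^ n / n.factorial) := by
  induction n generalizing t with
  | zero =>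
    have : cornerSimplex 0 t = Set.univ := by ext x; simp [cornerSimplex, ht]
    rw [this, volume_pi, Measure.pi_univ]
    simp
  | succ n ih =>
    have hmp := (volume_preserving_piFinSuccAbove (fun _ : Fin (n + 1) => ℝ) 0).symm
    rw [← hmp.measure_preimage (isClosed_cornerSimplex _ _).measurableSet.nullMeasurableSet,
      Measure.volume_eq_prod, Measure.prod_apply
        ((isClosed_cornerSimplex _ _).measurableSet.preimage hmp.measurable)]
    have hslice : ∀ s : ℝ, volume (Prod.mk s ⁻¹'
        ((MeasurableEquiv.piFinSuccAbove (fun _ : Fin (n + 1) => ℝ) 0).symm ⁻¹'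
          cornerSimplex (n + 1) t)) =
        (Set.Icc 0 t).indicator (fun s => ENNReal.ofReal ((t - s) ^ n / n.factorial)) s := by
      intro s
      have hset : Prod.mk s ⁻¹'
          ((MeasurableEquiv.piFinSuccAbove (fun _ : Fin (n + 1) => ℝ) 0).symm ⁻¹'
            cornerSimplex (n + 1) t) = {y | 0 ≤ s ∧ y ∈ cornerSimplex n (t - s)} := by
        ext y
        simp [cornerSimplex, Fin.forall_fin_succ, Fin.sum_univ_succ, le_sub_iff_add_le',
          MeasurableEquiv.piFinSuccAbove, Fin.insertNthEquiv, and_assoc]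
      rw [hset]
      by_cases hs : s ∈ Set.Icc 0 t
      · rw [Set.indicator_of_mem hs, ← ih (t - s) (sub_nonneg.2 hs.2)]
        simp [hs.1]
      · rw [Set.indicator_of_notMem hs]
        convert measure_empty (μ := volume)
        ext y
        simp only [Set.mem_ofPred_eq, Set.mem_empty_iff_false, iff_false, not_and]
        rintro h0 ⟨hy, hyt⟩
        exact hs ⟨h0, sub_nonneg.1 ((Finset.sum_nonneg fun i _ => hy i).trans hyt)⟩
    simp_rw [hslice]
    rw [lintegral_indicator measurableSet_Icc, ← ofReal_integral_eq_lintegral_ofReal,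
      integral_Icc_eq_integral_Ioc, ← intervalIntegral.integral_of_le ht]
    · congr 1
      rw [intervalIntegral.integral_div,
        intervalIntegral.integral_comp_sub_left (fun s => s ^ n) t]
      simp only [sub_self, sub_zero, integral_pow, Nat.factorial_succ]
      push_cast
      field_simp
      simp
    · exact (by fun_prop : Continuous fun s : ℝ => (t - s) ^ n / n.factorial).integrableOn_Icc
    · filter_upwards [ae_restrict_mem measurableSet_Icc] with s hs
      have := sub_nonneg.2 hs.2
      simp only [Pi.zero_apply]
      positivity

theorem abs_det_basisFun_le_prod_norm {d : ℕ} (v : Fin d → Euc d) :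
    |(EuclideanSpace.basisFun (Fin d) ℝ).toBasis.det v| ≤ ∏ i, ‖v i‖ := by
  have : Fact (Module.finrank ℝ (Euc d) = d) := ⟨by simp⟩
  let b := EuclideanSpace.basisFun (Fin d) ℝ
  rw [← b.toBasis.orientation.volumeForm_robust' b v]
  exact Orientation.abs_volumeForm_apply_le _ v

/-- A simplex all of whose edges have length at most `D` has volume at most `D ^ d / d!`. -/
theorem volume_convexHull_range_le {d : ℕ} (y : Fin (d + 1) → Euc d) (D : ℝ)
    (hy : ∀ i j, dist (y i) (y j) ≤ D) :
    volume (convexHull ℝ (Set.range y)) ≤ ENNReal.ofReal (D ^ d / d.factorial) := by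
  let b := EuclideanSpace.basisFun (Fin d) ℝ
  let v : Fin d → Euc d := fun k => y k.succ - y 0
  let L : Euc d →ₗ[ℝ] Euc d := b.toBasis.constr ℝ v
  have hL : ∀ k, L (b k) = v k := fun k => by
    simp [L]
  have hdet : LinearMap.det L = b.toBasis.det v := by
    have h := b.toBasis.det_comp L b.toBasis
    rw [b.toBasis.det_self, mul_one] at h
    rw [← h]
    congr 1
    ext1 k
    simp [hL]
  let C : Set (Euc d) := WithLp.linearEquiv 2 ℝ (Fin d → ℝ) ⁻¹' cornerSimplex d 1
  have hC : Convex ℝ C :=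
    (convex_cornerSimplex d 1).linear_preimage (WithLp.linearEquiv 2 ℝ (Fin d → ℝ)).toLinearMap
  have hvolC : volume C = ENNReal.ofReal (1 / d.factorial) := by
    rw [← one_pow d, ← volume_cornerSimplex d 1 zero_le_one]
    exact (PiLp.volume_preserving_ofLp (Fin d)).measure_preimage
      (isClosed_cornerSimplex _ _).measurableSet.nullMeasurableSet
  have hsub : convexHull ℝ (Set.range y) ⊆ (fun z => y 0 + z) '' (L '' C) := by
    refine convexHull_min ?_ ((hC.linear_image L).translate (y 0))
    rintro _ ⟨i, rfl⟩
    refine Fin.cases ?_ (fun k => ?_) i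
    · exact ⟨0, ⟨0, by simp [C, cornerSimplex], by simp⟩, by simp⟩
    · refine ⟨v k, ⟨b k, ?_, hL k⟩, by simp [v]⟩
      refine ⟨fun j => ?_, ?_⟩
      · by_cases h : j = k <;> simp [b, h]
      · simp [b]
  have hdetle : |LinearMap.det L| ≤ D ^ d := by
    rw [hdet]
    refine (abs_det_basisFun_le_prod_norm v).trans ?_
    calc ∏ i, ‖v i‖ ≤ ∏ _i : Fin d, D :=
          Finset.prod_le_prod (fun _ _ => norm_nonneg _)
            fun i _ => by simpa [v, dist_eq_norm] using hy i.succ 0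
      _ = D ^ d := by simp
  calc volume (convexHull ℝ (Set.range y))
      ≤ volume ((fun z => y 0 + z) '' (L '' C)) := measure_mono hsub
    _ = ENNReal.ofReal |LinearMap.det L| * ENNReal.ofReal (1 / d.factorial) := by
        rw [Set.image_add_left, measure_preimage_add, Measure.addHaar_image_linearMap, hvolC]
    _ ≤ ENNReal.ofReal (D ^ d / d.factorial) := by
        rw [← ENNReal.ofReal_mul (abs_nonneg _), mul_one_div]
        gcongr

theorem volume_image_affineEquiv {d : ℕ} (f : Euc d ≃ᵃ[ℝ] Euc d)
    (hf : |LinearMap.det (f.linear : Euc d →ₗ[ℝ] Euc d)| = 1) (s : Set (Euc d)) :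
    volume (f '' s) = volume s := by
  have h : f '' s = (fun z => f 0 + z) '' ((f.linear : Euc d →ₗ[ℝ] Euc d) '' s) := by
    rw [Set.image_image]
    refine Set.image_congr fun x _ => ?_
    have := f.map_vadd 0 x
    simpa [add_comm] using this
  rw [h, Set.image_add_left, measure_preimage_add, Measure.addHaar_image_linearMap, hf]
  simp

theorem mem_convexHull_range_iff {ι E : Type*} [Fintype ι] [AddCommGroup E] [Module ℝ E]
    (y : ι → E) (p : E) :
    p ∈ convexHull ℝ (Set.range y) ↔ ∃ w ∈ stdSimplex ℝ ι, ∑ i, w i • y i = p := by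
  classical
  have h : Set.range y = Fintype.linearCombination ℝ y ''
      Set.range (fun i j : ι => if i = j then (1 : ℝ) else 0) := by
    rw [← Set.range_comp]
    congr 1
    ext i
    simp [Fintype.linearCombination_apply]
  rw [h, ← LinearMap.image_convexHull, convexHull_basis_eq_stdSimplex]
  simp [Fintype.linearCombination_apply]

theorem isClosed_setOf_mem_convexHull_range (ι E : Type*) [Fintype ι] [NormedAddCommGroup E]
    [NormedSpace ℝ E] :
    IsClosed {q : E × (ι → E) | q.1 ∈ convexHull ℝ (Set.range q.2)} := by
  have h : {q : E × (ι → E) | q.1 ∈ convexHull ℝ (Set.range q.2)} =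
      Prod.fst '' {r : (E × (ι → E)) × stdSimplex ℝ ι |
        ∑ i, (r.2 : ι → ℝ) i • r.1.2 i = r.1.1} := by
    ext q
    simp only [Set.mem_ofPred_eq, mem_convexHull_range_iff, Set.mem_image]
    constructor
    · rintro ⟨w, hw, hq⟩
      exact ⟨(q, ⟨w, hw⟩), hq, rfl⟩
    · rintro ⟨⟨q, w⟩, hq, rfl⟩
      exact ⟨w, w.2, hq⟩
  rw [h]
  exact isClosedMap_fst_of_compactSpace _ (isClosed_eq
    (continuous_finsetSum _ fun i _ => ((continuous_apply i).comp
      (continuous_subtype_val.comp continuous_snd)).smul (by fun_prop)) (by fun_prop))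

theorem isProbabilityMeasure_unif {d : ℕ} {K : Set (Euc d)} (hK : IsConvexBody K) :
    IsProbabilityMeasure (unif K) := by
  refine ⟨?_⟩
  have h0 : volume K ≠ 0 := (Measure.measure_pos_of_nonempty_interior _ hK.2.2).ne'
  simp [unif, ENNReal.inv_mul_cancel h0 hK.2.1.measure_lt_top.ne]

/-- If every simplex with vertices in `K` has volume at most `c`, then the `i`-th of `d + 2` random
points of `K` lies in the convex hull of the others with probability at most `c / λ(K)`. -/
theorem measure_mem_convexHull_others_le {d : ℕ} {K : Set (Euc d)} (hK : IsConvexBody K)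
    (c : ENNReal) (hc : ∀ y : Fin (d + 1) → Euc d, (∀ j, y j ∈ K) →
      volume (convexHull ℝ (Set.range y)) ≤ c) (i : Fin (d + 2)) :
    (Measure.pi fun _ : Fin (d + 2) => unif K) {x | x i ∈ convexHull ℝ (x '' {j | j ≠ i})} ≤
      (volume K)⁻¹ * c := by
  have := isProbabilityMeasure_unif hK
  have hmeas := (isClosed_setOf_mem_convexHull_range (Fin (d + 1)) (Euc d)).measurableSet
  have hmp := measurePreserving_piFinSuccAbove (fun _ : Fin (d + 2) => unif K) i
  have hset : {x : Fin (d + 2) → Euc d | x i ∈ convexHull ℝ (x '' {j | j ≠ i})} =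
      MeasurableEquiv.piFinSuccAbove (fun _ : Fin (d + 2) => Euc d) i ⁻¹'
        {q | q.1 ∈ convexHull ℝ (Set.range q.2)} := by
    ext x
    have hrange : x '' {j | j ≠ i} = Set.range fun j => x (i.succAbove j) := by
      rw [show {j | j ≠ i} = Set.range i.succAbove by rw [Fin.range_succAbove]; rfl,
        ← Set.range_comp]
      rfl
    rw [Set.mem_ofPred_eq, hrange]
    rfl
  have hmemK : ∀ᵐ z ∂unif K, z ∈ K :=
    Measure.ae_smul_measure (ae_restrict_mem hK.2.1.measurableSet) _
  have hae : ∀ᵐ y ∂(Measure.pi fun _ : Fin (d + 1) => unif K), ∀ j, y j ∈ K :=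
    ae_all_iff.2 fun j =>
      (measurePreserving_eval (fun _ : Fin (d + 1) => unif K) j).quasiMeasurePreserving.ae hmemK
  rw [hset, hmp.measure_preimage hmeas.nullMeasurableSet, Measure.prod_apply_symm hmeas]
  calc ∫⁻ y, unif K ((fun p => (p, y)) ⁻¹' {q | q.1 ∈ convexHull ℝ (Set.range q.2)})
        ∂(Measure.pi fun _ : Fin (d + 1) => unif K)
      ≤ ∫⁻ _, (volume K)⁻¹ * c ∂(Measure.pi fun _ : Fin (d + 1) => unif K) := by
        refine lintegral_mono_ae ?_
        filter_upwards [hae] with y hy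
        simp only [unif, Measure.smul_apply, smul_eq_mul]
        gcongr
        exact (Measure.restrict_apply_le _ _).trans (hc y hy)
    _ = (volume K)⁻¹ * c := by simp

/-- Let `ε > 0`, `d ≥ 1`, and let `K ⊆ ℝ^d` be a convex body. If there is a
volume-preserving affine transformation `f` of `ℝ^d` such that `f(K)` has
diameter `D` with `D ≤ d^{1-ε} · λ_d(K)^{1/d}`, then
`p_d^K ≤ (d+2) · d^{(1-ε)d} / d!`. -/
theorem statement6 (ε : ℝ) (hε : 0 < ε) (d : ℕ) (hd : 1 ≤ d)
    (K : Set (Euc d)) (hK : IsConvexBody K)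
    (f : Euc d ≃ᵃ[ℝ] Euc d)
    (hf : |LinearMap.det (f.linear : Euc d →ₗ[ℝ] Euc d)| = 1)
    (D : ℝ) (hD : Metric.diam (⇑f '' K) = D)
    (hDsmall : D ≤ (d : ℝ) ^ ((1 : ℝ) - ε) * (volume K).toReal ^ ((1 : ℝ) / d)) :
    pSimplex d K ≤ ((d : ℝ) + 2) * (d : ℝ) ^ (((1 : ℝ) - ε) * d) /
      (Nat.factorial d : ℝ) := by
  have hV : 0 < (volume K).toReal := ENNReal.toReal_pos
    (Measure.measure_pos_of_nonempty_interior _ hK.2.2).ne' hK.2.1.measure_lt_top.ne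
  have hd0 : (d : ℝ) ≠ 0 := by exact_mod_cast (by omega : d ≠ 0)
  have hD0 : 0 ≤ D := hD ▸ Metric.diam_nonneg
  have hbdd : Bornology.IsBounded (f '' K) :=
    (hK.2.1.image f.continuous_of_finiteDimensional).isBounded
  have hsimplex : ∀ y : Fin (d + 1) → Euc d, (∀ j, y j ∈ K) →
      volume (convexHull ℝ (Set.range y)) ≤ ENNReal.ofReal (D ^ d / d.factorial) := by
    intro y hy
    have himage : f '' convexHull ℝ (Set.range y) = convexHull ℝ (Set.range (f ∘ y)) := by
      rw [Set.range_comp]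
      exact f.toAffineMap.image_convexHull _
    rw [← volume_image_affineEquiv f hf, himage]
    refine volume_convexHull_range_le _ D fun i j => hD ▸ ?_
    exact Metric.dist_le_diam_of_mem hbdd (Set.mem_image_of_mem f (hy i))
      (Set.mem_image_of_mem f (hy j))
  have hDpow : D ^ d ≤ (d : ℝ) ^ ((1 - ε) * d) * (volume K).toReal := by
    calc D ^ d ≤ ((d : ℝ) ^ (1 - ε) * (volume K).toReal ^ ((1 : ℝ) / d)) ^ d := by gcongr
      _ = (d : ℝ) ^ ((1 - ε) * d) * (volume K).toReal := by
        rw [mul_pow, ← Real.rpow_mul_natCast (by positivity), ← Real.rpow_mul_natCast hV.le,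
          one_div_mul_cancel hd0, Real.rpow_one]
  have hunion : (Measure.pi fun _ : Fin (d + 2) => unif K)
      {x : Fin (d + 2) → Euc d | ∃ i, x i ∈ convexHull ℝ (x '' {j | j ≠ i})} ≤
      (d + 2 : ℕ) * ((volume K)⁻¹ * ENNReal.ofReal (D ^ d / d.factorial)) := by
    rw [Set.ofPred_exists]
    refine (measure_iUnion_fintype_le _ _).trans ?_
    refine (Finset.sum_le_sum fun i _ => measure_mem_convexHull_others_le hK _ hsimplex i).trans ?_
    simp
  have hfin : (volume K)⁻¹ ≠ ⊤ :=
    ENNReal.inv_ne_top.2 (Measure.measure_pos_of_nonempty_interior _ hK.2.2).ne'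
  have hreal := ENNReal.toReal_mono (ENNReal.mul_ne_top (ENNReal.natCast_ne_top _)
    (ENNReal.mul_ne_top hfin ENNReal.ofReal_ne_top)) hunion
  refine hreal.trans ?_
  rw [ENNReal.toReal_mul, ENNReal.toReal_mul, ENNReal.toReal_natCast, ENNReal.toReal_inv,
    ENNReal.toReal_ofReal (by positivity), mul_div_assoc]
  push_cast
  gcongr
  rw [inv_mul_le_iff₀ hV, mul_div_assoc', mul_comm (volume K).toReal]
  gcongr
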